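/- For every α, β, γ ∈ (0,1) with β + γ > 1 there exist generalised Cantor sets C, D ⊂ [0,1] such that dim_LB C = α(1−γ), dim_B C = αβ, dim_LB D = α(1−β), dim_B D = αγ, and, with C×D ⊂ ℝ² carrying the Euclidean metric, dim_LB(C×D) = dim_B(C×D) = dim_A(C×D) = dim_A C = dim_A D = α. -/

import Mathlib

open Metric Set Filter
open scoped ENNReal NNReal

namespace Paper

noncomputable def coverNum {X : Type*} [MetricSpace X] (F : Set X) (r : ℝ) : ℝ≥0∞ :=
  ⨅ (s : Finset X) (_ : F ⊆ ⋃ x ∈ s, closedBall x r), (s.card : ℝ≥0∞)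

noncomputable def diamCoverNum {X : Type*} [MetricSpace X] (F : Set X) (r : ℝ) : ℝ≥0∞ :=
  ⨅ (U : Finset (Set X)) (_ : F ⊆ ⋃₀ ↑U)
    (_ : ∀ A ∈ U, EMetric.diam A ≤ ENNReal.ofReal r), (U.card : ℝ≥0∞)

noncomputable def lowerBoxDim {X : Type*} [MetricSpace X] (F : Set X) : ℝ :=
  Filter.liminf (fun r : ℝ => Real.log (coverNum F r).toReal / (-Real.log r))
    (nhdsWithin 0 (Set.Ioi 0))

noncomputable def upperBoxDim {X : Type*} [MetricSpace X] (F : Set X) : ℝ :=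
  Filter.limsup (fun r : ℝ => Real.log (coverNum F r).toReal / (-Real.log r))
    (nhdsWithin 0 (Set.Ioi 0))

def IsHomogeneous {X : Type*} [MetricSpace X] (F : Set X) (s : ℝ) : Prop :=
  ∀ δ₀ : ℝ, 0 < δ₀ → ∃ C : ℝ, 0 < C ∧
    ∀ x ∈ F, ∀ δ ρ : ℝ, 0 < ρ → ρ < δ → δ ≤ δ₀ →
      coverNum (closedBall x δ ∩ F) ρ ≤ ENNReal.ofReal (C * (δ / ρ) ^ s)

noncomputable def assouadDim {X : Type*} [MetricSpace X] (F : Set X) : EReal :=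
  sInf ((fun s : ℝ => (s : EReal)) '' {s : ℝ | 0 ≤ s ∧ IsHomogeneous F s})

def EquiHomogeneous {X : Type*} [MetricSpace X] (F : Set X) : Prop :=
  ∀ δ₀ : ℝ, 0 < δ₀ → ∃ M : ℝ≥0, 1 ≤ M ∧ ∃ c₁ c₂ : ℝ, 0 < c₁ ∧ 0 < c₂ ∧
    ∀ δ ρ : ℝ, 0 < ρ → ρ < δ → δ ≤ δ₀ →
      (⨆ x ∈ F, coverNum (closedBall x δ ∩ F) ρ) ≤
        (M : ℝ≥0∞) * ⨅ x ∈ F, coverNum (closedBall x (c₁ * δ) ∩ F) (c₂ * ρ)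

noncomputable def cantorLen (lam : ℕ → ℝ) (n : ℕ) : ℝ := ∏ i ∈ Finset.range n, lam i

noncomputable def cantorPre (lam : ℕ → ℝ) (n : ℕ) : Set ℝ :=
  ⋃ ε : ℕ → Bool,
    Set.Icc (∑ i ∈ Finset.range n, if ε i then cantorLen lam i - cantorLen lam (i + 1) else 0)
      ((∑ i ∈ Finset.range n, if ε i then cantorLen lam i - cantorLen lam (i + 1) else 0) +
        cantorLen lam n)

noncomputable def cantorSet (lam : ℕ → ℝ) : Set ℝ := ⋂ n : ℕ, cantorPre lam n

open Classical in
noncomputable def lamSeq (q : ℝ) (a : ℕ → ℕ) (i : ℕ) : ℝ :=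
  if h : ∃ k : ℕ, i + 1 = ∑ j ∈ Finset.range (k + 1), a (2 * j) then
    q ^ (a (2 * h.choose + 1) + 1)
  else q

open Classical in
noncomputable def muSeq (q : ℝ) (a : ℕ → ℕ) (i : ℕ) : ℝ :=
  if h : ∃ k : ℕ, i + 1 = a 0 + ∑ j ∈ Finset.range (k + 1), a (2 * j + 1) then
    q ^ (a (2 * h.choose + 2) + 1)
  else q

noncomputable def prodSetL2 (C D : Set ℝ) : Set (WithLp 2 (ℝ × ℝ)) :=
  (WithLp.equiv 2 (ℝ × ℝ)).symm '' (C ×ˢ D)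

/-- `φ` codes the points of its range by binary sequences, only the digits at the times `s` with
`p s` being relevant: agreement of the relevant digits before time `t` is comparable to being at
distance of order `q ^ t`. -/
structure IsCoding (p : ℕ → Prop) {X : Type*} [MetricSpace X] (φ : (ℕ → Bool) → X)
    (q A a : ℝ) : Prop where
  q_pos : 0 < q
  q_lt_one : q < 1
  a_pos : 0 < a
  a_le : a ≤ A
  dist_le : ∀ t x y, (∀ s < t, p s → x s = y s) → dist (φ x) (φ y) ≤ A * q ^ t
  le_dist : ∀ t x y, ∀ s < t, p s → x s ≠ y s → a * q ^ t ≤ dist (φ x) (φ y)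

/-- The sequences agreeing with `x` at the relevant times before `t`. -/
def cylinder (p : ℕ → Prop) (x : ℕ → Bool) (t : ℕ) : Set (ℕ → Bool) :=
  {y | ∀ s < t, p s → y s = x s}

theorem cylinder_zero (p : ℕ → Prop) (x : ℕ → Bool) : cylinder p x 0 = univ := by
  simp [cylinder]

section Coding

variable {p : ℕ → Prop} [DecidablePred p] {X : Type*} [MetricSpace X] {φ : (ℕ → Bool) → X}
  {q A a : ℝ}

theorem IsCoding.coverNum_le (h : IsCoding p φ q A a) {G : Set X} {x : ℕ → Bool} {t t' : ℕ}
    {ρ : ℝ} (hG : G ⊆ φ '' cylinder p x t) (hρ : A * q ^ t' ≤ ρ) :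
    coverNum G ρ ≤ 2 ^ ((Finset.Ico t t').filter p).card := by
  classical
  let z : Finset ℕ → ℕ → Bool := fun U s => if s < t then x s else decide (s ∈ U)
  let s := (((Finset.Ico t t').filter p).powerset).image fun U => φ (z U)
  have hs : G ⊆ ⋃ c ∈ s, closedBall c ρ := by
    intro w hw
    obtain ⟨y, hy, rfl⟩ := hG hw
    let U := ((Finset.Ico t t').filter p).filter fun i => y i = true
    refine mem_biUnion (x := φ (z U)) ?_ ?_
    · exact Finset.mem_coe.2 (Finset.mem_image_of_mem _
        (Finset.mem_powerset.2 (Finset.filter_subset _ _)))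
    · refine mem_closedBall.2 ((h.dist_le t' _ _ fun i hi hp => ?_).trans hρ)
      by_cases hit : i < t
      · simp [z, hit, hy i hit hp]
      · cases hyi : y i <;> simp [z, U, hit, hi, hp, hyi, not_lt.1 hit]
  calc coverNum G ρ ≤ (s.card : ℝ≥0∞) := iInf₂_le s hs
    _ ≤ ((2 ^ ((Finset.Ico t t').filter p).card : ℕ) : ℝ≥0∞) := by
        gcongr
        exact Finset.card_image_le.trans (Finset.card_powerset _).le
    _ = _ := by push_cast; rfl

theorem IsCoding.le_coverNum (h : IsCoding p φ q A a) {G : Set X} {x : ℕ → Bool} {t t' : ℕ}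
    {ρ : ℝ} (hG : φ '' cylinder p x t ⊆ G) (hρ : 2 * ρ < a * q ^ t') :
    2 ^ ((Finset.Ico t t').filter p).card ≤ coverNum G ρ := by
  classical
  let z : Finset ℕ → ℕ → Bool := fun U s => if s < t then x s else decide (s ∈ U)
  refine le_iInf₂ fun s hs => ?_
  have hc : ∀ U : Finset ℕ, ∃ c ∈ s, φ (z U) ∈ closedBall c ρ := fun U => by
    have : φ (z U) ∈ ⋃ c ∈ s, closedBall c ρ :=
      hs (hG ⟨_, fun i hi _ => by simp [z, hi], rfl⟩)
    simpa using this
  choose c hcs hcb using hc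
  have hinj : ∀ U ∈ ((Finset.Ico t t').filter p).powerset,
      ∀ V ∈ ((Finset.Ico t t').filter p).powerset, c U = c V → U ⊆ V := by
    intro U hU V hV hUV i hiU
    by_contra hiV
    have hi := Finset.mem_powerset.1 hU hiU
    simp only [Finset.mem_filter, Finset.mem_Ico] at hi
    have h1 := h.le_dist t' (z U) (z V) i hi.1.2 hi.2 (by
      simp [z, not_lt.2 hi.1.1, hiU, hiV])
    have h2 := dist_triangle_right (φ (z U)) (φ (z V)) (c U)
    have h3 := mem_closedBall.1 (hcb U)
    have h4 := mem_closedBall.1 (hcb V)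
    rw [← hUV] at h4
    linarith
  have := Finset.card_le_card_of_injOn c (fun U _ => hcs U)
    (s := ((Finset.Ico t t').filter p).powerset) fun U hU V hV hUV =>
      (hinj U hU V hV hUV).antisymm (hinj V hV U hU hUV.symm)
  rw [Finset.card_powerset] at this
  exact_mod_cast this

theorem card_filter_Ico_add_count {t t' : ℕ} (h : t ≤ t') :
    Nat.count p t + ((Finset.Ico t t').filter p).card = Nat.count p t' := by
  rw [Nat.count_eq_card_filter_range, Nat.count_eq_card_filter_range,
    Finset.range_eq_Ico, Finset.range_eq_Ico, ← Finset.card_union_of_disjoint,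
    ← Finset.filter_union, Finset.Ico_union_Ico_eq_Ico (Nat.zero_le _) h]
  exact Finset.disjoint_filter_filter (Finset.Ico_disjoint_Ico_consecutive 0 t t')

theorem card_filter_Ico_le (t t' : ℕ) : ((Finset.Ico t t').filter p).card ≤ t' - t :=
  (Finset.card_filter_le _ _).trans (Nat.card_Ico _ _).le

theorem exists_nat_pow_le {q r : ℝ} (hq : 0 < q) (hq1 : q < 1) (hr : 0 < r) :
    ∃ t : ℕ, q ^ (t + 1) ≤ r ∧ (t = 0 ∨ r ≤ q ^ t) := by
  rcases le_total r 1 with h | h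
  · obtain ⟨n, h1, h2⟩ := exists_nat_pow_near_of_lt_one hr h hq hq1
    exact ⟨n, h1.le, Or.inr h2⟩
  · exact ⟨0, by simpa using hq1.le.trans h, Or.inl rfl⟩

theorem IsCoding.isHomogeneous (h : IsCoding p φ q A a) {α : ℝ} (hα : 0 < α)
    (hqα : q ^ α = 2⁻¹) : IsHomogeneous (range φ) α := by
  obtain ⟨q0, q1, a0, haA, hle, hge⟩ := id h
  have hA : 0 < A := a0.trans_le haA
  intro δ₀ _
  refine ⟨max 2 ((2 * A / (a * q ^ 2)) ^ α), by positivity, ?_⟩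
  rintro _ ⟨x, rfl⟩ δ ρ hρ hδ -
  have hδ0 := hρ.trans hδ
  obtain ⟨t, ht, ht'⟩ := exists_nat_pow_le q0 q1 (r := 2 * δ / a) (by positivity)
  obtain ⟨τ, hτ, hτ'⟩ := exists_nat_pow_le q0 q1 (r := ρ / A) (by positivity)
  have hG : closedBall (φ x) δ ∩ range φ ⊆ φ '' cylinder p x t := by
    rintro _ ⟨hy, y, rfl⟩
    refine ⟨y, fun s hs hp => ?_, rfl⟩
    by_contra hne
    have h1 := hge t y x s hs hp hne
    have h2 := mem_closedBall.1 hy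
    rcases ht' with rfl | ht'
    · simp at hs
    · rw [div_le_iff₀ a0] at ht'
      linarith
  refine (h.coverNum_le hG (t' := τ + 1) (by
    rw [le_div_iff₀ hA] at hτ; linarith)).trans ?_
  have hone : 1 ≤ (δ / ρ) ^ α := Real.one_le_rpow ((one_le_div hρ).2 hδ.le) hα.le
  have key : (2 : ℝ) ^ (τ + 1 - t) ≤ max 2 ((2 * A / (a * q ^ 2)) ^ α) * (δ / ρ) ^ α := by
    rcases hτ' with rfl | hτ'
    · calc (2 : ℝ) ^ (0 + 1 - t) ≤ 2 ^ 1 := pow_le_pow_right₀ (by norm_num) (by omega)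
        _ = 2 * 1 := by norm_num
        _ ≤ _ := mul_le_mul (le_max_left _ _) hone zero_le_one (by positivity)
    rcases le_total (τ + 1) t with htt | htt
    · rw [Nat.sub_eq_zero_of_le htt, pow_zero]
      nlinarith [le_max_left (2 : ℝ) ((2 * A / (a * q ^ 2)) ^ α)]
    · have hpow : (2 : ℝ) ^ (τ + 1 - t) = (q ^ t / q ^ (τ + 1)) ^ α := by
        have : q ^ t / q ^ (τ + 1) = (q ^ (τ + 1 - t))⁻¹ := by
          rw [← Nat.sub_add_cancel htt, pow_add]
          simp only [Nat.add_sub_cancel]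
          field_simp
        rw [this, Real.inv_rpow (by positivity), ← Real.rpow_pow_comm q0.le, hqα]
        simp
      rw [hpow]
      have hbase : q ^ t / q ^ (τ + 1) ≤ 2 * A / (a * q ^ 2) * (δ / ρ) := by
        rw [div_le_iff₀ (by positivity)]
        have e1 : q ^ t ≤ 2 * δ / (a * q) := by
          rw [le_div_iff₀ (by positivity)]
          rw [le_div_iff₀ a0, pow_succ] at ht
          linarith
        have e2 : ρ / A * q ≤ q ^ (τ + 1) := by
          rw [pow_succ]
          gcongr
        calc q ^ t ≤ 2 * δ / (a * q) := e1
          _ = 2 * A / (a * q ^ 2) * (δ / ρ) * (ρ / A * q) := by field_simp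
          _ ≤ _ := by gcongr
      calc (q ^ t / q ^ (τ + 1)) ^ α ≤ (2 * A / (a * q ^ 2) * (δ / ρ)) ^ α := by gcongr
        _ = (2 * A / (a * q ^ 2)) ^ α * (δ / ρ) ^ α :=
            Real.mul_rpow (by positivity) (by positivity)
        _ ≤ _ := by gcongr; exact le_max_right _ _
  calc (2 : ℝ≥0∞) ^ ((Finset.Ico t (τ + 1)).filter p).card ≤ 2 ^ (τ + 1 - t) :=
        pow_le_pow_right₀ (by norm_num) (card_filter_Ico_le _ _)
    _ = ENNReal.ofReal ((2 : ℝ) ^ (τ + 1 - t)) := by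
        rw [ENNReal.ofReal_pow (by norm_num)]; norm_num
    _ ≤ _ := ENNReal.ofReal_le_ofReal key

/-- Arbitrarily long blocks of times of which all but boundedly many are relevant. -/
def HasDenseBlocks (p : ℕ → Prop) [DecidablePred p] : Prop :=
  ∃ B : ℕ, ∀ k : ℕ, ∃ t t' : ℕ, t + k ≤ t' ∧ t' + Nat.count p t ≤ t + Nat.count p t' + B

theorem IsCoding.le_of_isHomogeneous (h : IsCoding p φ q A a) {α s : ℝ}
    (hqα : q ^ α = 2⁻¹) (hp : HasDenseBlocks p) (hs : IsHomogeneous (range φ) s) : α ≤ s := by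
  obtain ⟨q0, q1, a0, haA, hle, hge⟩ := id h
  have hA : 0 < A := a0.trans_le haA
  obtain ⟨B, hB⟩ := hp
  obtain ⟨C, hC0, hC⟩ := hs A hA
  by_contra! hsα
  have hqs : 2⁻¹ < q ^ s := hqα ▸ Real.rpow_lt_rpow_of_exponent_gt q0 q1 hsα
  have hb : 1 < 2 * q ^ s := by linarith
  obtain ⟨k, hk⟩ := pow_unbounded_of_one_lt (2 ^ B * (C * (3 * A / a) ^ s)) hb
  obtain ⟨t, t', htk, htB⟩ := hB k
  have htt : t ≤ t' := by omega
  have hρδ : a * q ^ t' / 3 < A * q ^ t := by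
    have h1 : a * q ^ t' ≤ A * q ^ t :=
      mul_le_mul haA (pow_le_pow_of_le_one q0.le q1.le htt) (by positivity) hA.le
    have h2 : 0 < a * q ^ t' := by positivity
    linarith
  let x : ℕ → Bool := fun _ => false
  have h1 := hC (φ x) ⟨x, rfl⟩ (A * q ^ t) (a * q ^ t' / 3) (by positivity) hρδ
    (mul_le_of_le_one_right hA.le (pow_le_one₀ q0.le q1.le))
  have hG : φ '' cylinder p x t ⊆ closedBall (φ x) (A * q ^ t) ∩ range φ := by
    rintro _ ⟨y, hy, rfl⟩
    exact ⟨mem_closedBall.2 (hle t y x hy), y, rfl⟩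
  have h2 := (h.le_coverNum hG (t' := t') (ρ := a * q ^ t' / 3) (by
    have : 0 < a * q ^ t' := by positivity
    linarith)).trans h1
  have hcard := card_filter_Ico_add_count (p := p) htt
  have h3 : (2 : ℝ) ^ ((Finset.Ico t t').filter p).card
      ≤ C * (A * q ^ t / (a * q ^ t' / 3)) ^ s := by
    rw [← ENNReal.ofReal_le_ofReal_iff (by positivity), ENNReal.ofReal_pow (by norm_num)]
    simpa using h2
  have h4 : (2 : ℝ) ^ (t' - t) ≤ 2 ^ B * 2 ^ ((Finset.Ico t t').filter p).card := by
    rw [← pow_add]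
    exact pow_le_pow_right₀ (by norm_num) (by omega)
  have h5 : (A * q ^ t / (a * q ^ t' / 3)) ^ s = (3 * A / a) ^ s * ((q ^ s) ^ (t' - t))⁻¹ := by
    have : A * q ^ t / (a * q ^ t' / 3) = (3 * A / a) * (q ^ (t' - t))⁻¹ := by
      rw [← Nat.sub_add_cancel htt, pow_add]
      simp only [Nat.add_sub_cancel]
      field_simp
    rw [this, Real.mul_rpow (by positivity) (by positivity), Real.inv_rpow (by positivity),
      ← Real.rpow_pow_comm q0.le]
  have h6 : (2 * q ^ s) ^ (t' - t) ≤ 2 ^ B * (C * (3 * A / a) ^ s) := by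
    rw [mul_pow]
    calc (2 : ℝ) ^ (t' - t) * (q ^ s) ^ (t' - t)
        ≤ 2 ^ B * (C * ((3 * A / a) ^ s * ((q ^ s) ^ (t' - t))⁻¹)) * (q ^ s) ^ (t' - t) := by
          rw [← h5]
          gcongr
          exact h4.trans (by gcongr)
      _ = _ := by
          have : (q ^ s) ^ (t' - t) ≠ 0 := by positivity
          field_simp
  have h7 : (2 * q ^ s) ^ k ≤ (2 * q ^ s) ^ (t' - t) := pow_le_pow_right₀ hb.le (by omega)
  linarith

theorem IsCoding.assouadDim_eq (h : IsCoding p φ q A a) {α : ℝ} (hα : 0 < α)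
    (hqα : q ^ α = 2⁻¹) (hp : HasDenseBlocks p) : assouadDim (range φ) = (α : EReal) := by
  refine le_antisymm (sInf_le ⟨α, ⟨hα.le, h.isHomogeneous hα hqα⟩, rfl⟩) (le_sInf ?_)
  rintro _ ⟨s, ⟨-, hs⟩, rfl⟩
  exact EReal.coe_le_coe_iff.2 (h.le_of_isHomogeneous hqα hp hs)

theorem IsCoding.exists_abs_log_coverNum_sub_le (h : IsCoding p φ q A a) :
    ∃ K : ℝ, ∃ T : ℕ, ∀ t ≥ T, ∀ ρ, q ^ (t + 1) ≤ ρ → ρ ≤ q ^ t →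
      |Real.log (coverNum (range φ) ρ).toReal - Nat.count p t * Real.log 2| ≤ K := by
  obtain ⟨q0, q1, a0, haA, hle, hge⟩ := id h
  have hA : 0 < A := a0.trans_le haA
  have hl2 : 0 < Real.log 2 := Real.log_pos (by norm_num)
  obtain ⟨i, hi⟩ := exists_pow_lt_of_lt_one (y := q) (half_pos a0) q1
  obtain ⟨j, hj⟩ := exists_pow_lt_of_lt_one (y := q) (inv_pos.2 hA) q1
  refine ⟨(i + (j + 1)) * Real.log 2, i, fun t ht ρ hρ hρ' => ?_⟩
  let x : ℕ → Bool := fun _ => false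
  have hcyl : φ '' cylinder p x 0 = range φ := by rw [cylinder_zero, image_univ]
  have hcard : ∀ m, ((Finset.Ico 0 m).filter p).card = Nat.count p m := fun m => by
    simpa using card_filter_Ico_add_count (p := p) (Nat.zero_le m)
  have hup := h.coverNum_le hcyl.ge (t' := t + (j + 1)) (ρ := ρ) (by
    calc A * q ^ (t + (j + 1)) = A * q ^ j * q ^ (t + 1) := by ring
      _ ≤ A * A⁻¹ * q ^ (t + 1) := by gcongr
      _ = q ^ (t + 1) := by rw [mul_inv_cancel₀ hA.ne', one_mul]
      _ ≤ ρ := hρ)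
  have hlow := h.le_coverNum hcyl.le (t' := t - i) (ρ := ρ) (by
    calc 2 * ρ ≤ 2 * q ^ t := by gcongr
      _ = 2 * q ^ i * q ^ (t - i) := by rw [mul_assoc, ← pow_add, Nat.add_sub_cancel' ht]
      _ < 2 * (a / 2) * q ^ (t - i) := by gcongr
      _ = a * q ^ (t - i) := by ring)
  rw [hcard] at hup hlow
  have htop : coverNum (range φ) ρ ≠ ⊤ := ne_top_of_le_ne_top (by finiteness) hup
  have hup' : (coverNum (range φ) ρ).toReal ≤ 2 ^ Nat.count p (t + (j + 1)) := by
    simpa using ENNReal.toReal_mono (by finiteness) hup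
  have hlow' : 2 ^ Nat.count p (t - i) ≤ (coverNum (range φ) ρ).toReal := by
    simpa using ENNReal.toReal_mono htop hlow
  have hc1 : Nat.count p (t + (j + 1)) ≤ Nat.count p t + (j + 1) := by
    rw [Nat.count_add]; gcongr; exact Nat.count_le _
  have hc2 : Nat.count p t ≤ Nat.count p (t - i) + i := by
    conv_lhs => rw [← Nat.sub_add_cancel ht, Nat.count_add]
    gcongr; exact Nat.count_le _
  have hl1 := Real.log_le_log (by positivity) hlow'
  have hl2' := Real.log_le_log (lt_of_lt_of_le (by positivity) hlow') hup'
  rw [Real.log_pow] at hl1 hl2'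
  have hc1' : (Nat.count p (t + (j + 1)) : ℝ) ≤ Nat.count p t + (j + 1) := by exact_mod_cast hc1
  have hc2' : (Nat.count p t : ℝ) ≤ Nat.count p (t - i) + i := by exact_mod_cast hc2
  rw [abs_le]
  have hi0 : (0 : ℝ) ≤ i * Real.log 2 := by positivity
  have hj0 : (0 : ℝ) ≤ (j + 1) * Real.log 2 := by positivity
  constructor <;> nlinarith

theorem limsup_eq_of_forall_pos {ι : Type*} {l : Filter ι} {f : ι → ℝ} {L : ℝ}
    (hle : ∀ ε > 0, ∀ᶠ x in l, f x ≤ L + ε) (hge : ∀ ε > 0, ∃ᶠ x in l, L - ε ≤ f x) :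
    limsup f l = L := by
  have hcob : l.IsCoboundedUnder (· ≤ ·) f :=
    IsCoboundedUnder.of_frequently_ge (hge 1 one_pos)
  have hbdd : l.IsBoundedUnder (· ≤ ·) f := ⟨L + 1, hle 1 one_pos⟩
  refine le_antisymm (le_of_forall_pos_le_add fun ε hε => ?_)
    (le_of_forall_pos_sub_le fun ε hε => ?_)
  · exact limsup_le_of_le hcob (hle ε hε)
  · exact le_limsup_of_frequently_le (hge ε hε) hbdd

theorem liminf_eq_of_forall_pos {ι : Type*} {l : Filter ι} {f : ι → ℝ} {L : ℝ}
    (hge : ∀ ε > 0, ∀ᶠ x in l, L - ε ≤ f x) (hle : ∀ ε > 0, ∃ᶠ x in l, f x ≤ L + ε) :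
    liminf f l = L := by
  have hcob : l.IsCoboundedUnder (· ≥ ·) f :=
    IsCoboundedUnder.of_frequently_le (hle 1 one_pos)
  have hbdd : l.IsBoundedUnder (· ≥ ·) f := ⟨L - 1, hge 1 one_pos⟩
  refine le_antisymm (le_of_forall_pos_le_add fun ε hε => ?_)
    (le_of_forall_pos_sub_le fun ε hε => ?_)
  · exact liminf_le_of_frequently_le (hle ε hε) hbdd
  · exact le_liminf_of_le hcob (hge ε hε)

theorem eventually_exists_pow_bracket {q : ℝ} (hq : 0 < q) (hq1 : q < 1) (T : ℕ) :
    ∀ᶠ ρ in nhdsWithin (0 : ℝ) (Ioi 0), ρ < 1 ∧ ∃ t ≥ T, q ^ (t + 1) ≤ ρ ∧ ρ ≤ q ^ t := by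
  filter_upwards [Ioo_mem_nhdsGT (pow_pos hq T), Ioo_mem_nhdsGT one_pos] with ρ h1 h2
  obtain ⟨t, ht, ht'⟩ := exists_nat_pow_near_of_lt_one h1.1 h2.2.le hq hq1
  refine ⟨h2.2, t, ?_, ht.le, ht'⟩
  by_contra! hlt
  exact (ht.trans h1.2).not_ge (pow_le_pow_of_le_one hq.le hq1.le hlt)

theorem eventually_div_neg_log_le (C : ℝ) {ε : ℝ} (hε : 0 < ε) :
    ∀ᶠ ρ in nhdsWithin (0 : ℝ) (Ioi 0), C / (-Real.log ρ) ≤ ε := by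
  have h1 : Tendsto (fun ρ : ℝ => -Real.log ρ) (nhdsWithin 0 (Ioi 0)) atTop :=
    tendsto_neg_atBot_atTop.comp Real.tendsto_log_nhdsGT_zero
  exact (h1.const_div_atTop C).eventually_le_const hε

theorem tendsto_pow_nhdsGT_zero {q : ℝ} (hq : 0 < q) (hq1 : q < 1) :
    Tendsto (fun t : ℕ => q ^ t) atTop (nhdsWithin (0 : ℝ) (Ioi 0)) :=
  tendsto_nhdsWithin_iff.2 ⟨tendsto_pow_atTop_nhds_zero_of_lt_one hq.le hq1,
    Eventually.of_forall fun t => pow_pos hq t⟩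

section BoxDim

variable {α : ℝ}

theorem IsCoding.eventually_boxRatio_le (h : IsCoding p φ q A a)
    (hα : Real.log 2 = α * -Real.log q) {U B : ℝ} (hU : 0 ≤ U)
    (hB : ∀ t, (Nat.count p t : ℝ) ≤ U * t + B) {ε : ℝ} (hε : 0 < ε) :
    ∀ᶠ ρ in nhdsWithin (0 : ℝ) (Ioi 0),
      Real.log (coverNum (range φ) ρ).toReal / (-Real.log ρ) ≤ α * U + ε := by
  have q0 := h.q_pos
  have q1 := h.q_lt_one
  have hl2 : 0 < Real.log 2 := Real.log_pos (by norm_num)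
  have hlq : Real.log q < 0 := Real.log_neg q0 q1
  have hα0 : 0 < α := by nlinarith
  obtain ⟨K, T, hK⟩ := h.exists_abs_log_coverNum_sub_le
  filter_upwards [eventually_exists_pow_bracket q0 q1 T, self_mem_nhdsWithin,
    eventually_div_neg_log_le (K + B * Real.log 2) hε] with ρ ⟨hρ1, t, ht, h1, h2⟩ hρ0 hC
  have hy : 0 < -Real.log ρ := neg_pos.2 (Real.log_neg hρ0 hρ1)
  have hK' := (abs_le.1 (hK t ht ρ h1 h2)).2
  have ht1 : Real.log ρ ≤ t * Real.log q := by
    simpa using Real.log_le_log hρ0 h2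
  rw [div_le_iff₀ hy] at hC ⊢
  have h3 : (Nat.count p t : ℝ) * Real.log 2 ≤ (U * t + B) * Real.log 2 := by
    gcongr; exact hB t
  have h4 : U * t * Real.log 2 ≤ α * U * (-Real.log ρ) := by
    calc U * t * Real.log 2 = α * U * (-(t * Real.log q)) := by rw [hα]; ring
      _ ≤ _ := by gcongr
  linarith

theorem IsCoding.eventually_le_boxRatio (h : IsCoding p φ q A a)
    (hα : Real.log 2 = α * -Real.log q) {V B : ℝ} (hV : 0 ≤ V)
    (hB : ∀ t, V * t - B ≤ (Nat.count p t : ℝ)) {ε : ℝ} (hε : 0 < ε) :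
    ∀ᶠ ρ in nhdsWithin (0 : ℝ) (Ioi 0),
      α * V - ε ≤ Real.log (coverNum (range φ) ρ).toReal / (-Real.log ρ) := by
  have q0 := h.q_pos
  have q1 := h.q_lt_one
  have hl2 : 0 < Real.log 2 := Real.log_pos (by norm_num)
  have hlq : Real.log q < 0 := Real.log_neg q0 q1
  have hα0 : 0 < α := by nlinarith
  obtain ⟨K, T, hK⟩ := h.exists_abs_log_coverNum_sub_le
  filter_upwards [eventually_exists_pow_bracket q0 q1 T, self_mem_nhdsWithin,
    eventually_div_neg_log_le (K + (B + V) * Real.log 2) hε] with ρ ⟨hρ1, t, ht, h1, h2⟩ hρ0 hC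
  have hy : 0 < -Real.log ρ := neg_pos.2 (Real.log_neg hρ0 hρ1)
  have hK' := (abs_le.1 (hK t ht ρ h1 h2)).1
  have ht1 : (t + 1) * Real.log q ≤ Real.log ρ := by
    simpa using Real.log_le_log (by positivity) h1
  rw [div_le_iff₀ hy] at hC
  rw [le_div_iff₀ hy]
  have h3 : (V * t - B) * Real.log 2 ≤ (Nat.count p t : ℝ) * Real.log 2 := by
    gcongr; exact hB t
  have h4 : α * V * (-Real.log ρ) ≤ V * (t + 1) * Real.log 2 := by
    calc α * V * (-Real.log ρ) ≤ α * V * (-((t + 1) * Real.log q)) := by gcongr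
      _ = _ := by rw [hα]; ring
  linarith

theorem IsCoding.frequently_le_boxRatio (h : IsCoding p φ q A a)
    (hα : Real.log 2 = α * -Real.log q) {U B : ℝ}
    (hB : ∃ᶠ t : ℕ in atTop, U * t - B ≤ (Nat.count p t : ℝ)) {ε : ℝ} (hε : 0 < ε) :
    ∃ᶠ ρ in nhdsWithin (0 : ℝ) (Ioi 0),
      α * U - ε ≤ Real.log (coverNum (range φ) ρ).toReal / (-Real.log ρ) := by
  have q0 := h.q_pos
  have q1 := h.q_lt_one
  have hl2 : 0 < Real.log 2 := Real.log_pos (by norm_num)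
  have hlq : Real.log q < 0 := Real.log_neg q0 q1
  obtain ⟨K, T, hK⟩ := h.exists_abs_log_coverNum_sub_le
  have hlim := tendsto_pow_nhdsGT_zero q0 q1
  refine hlim.frequently ((hB.and_eventually ((eventually_ge_atTop (max T 1)).and
    (hlim.eventually (eventually_div_neg_log_le (K + B * Real.log 2) hε)))).mono ?_)
  rintro t ⟨h3, ht, hC⟩
  have ht0 : (0 : ℝ) < t := Nat.cast_pos.2 ((le_max_right T 1).trans ht)
  have hK' := (abs_le.1 (hK t ((le_max_left T 1).trans ht) (q ^ t)
    (pow_le_pow_of_le_one q0.le q1.le t.le_succ) le_rfl)).1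
  have hlog : -Real.log (q ^ t) = t * -Real.log q := by rw [Real.log_pow]; ring
  have hy : 0 < t * -Real.log q := by nlinarith
  rw [hlog] at hC ⊢
  rw [div_le_iff₀ hy] at hC
  rw [le_div_iff₀ hy]
  have h4 : (U * t - B) * Real.log 2 ≤ (Nat.count p t : ℝ) * Real.log 2 := by gcongr
  have h5 : α * U * (t * -Real.log q) = U * t * Real.log 2 := by rw [hα]; ring
  linarith

theorem IsCoding.frequently_boxRatio_le (h : IsCoding p φ q A a)
    (hα : Real.log 2 = α * -Real.log q) {V B : ℝ}
    (hB : ∃ᶠ t : ℕ in atTop, (Nat.count p t : ℝ) ≤ V * t + B) {ε : ℝ} (hε : 0 < ε) :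
    ∃ᶠ ρ in nhdsWithin (0 : ℝ) (Ioi 0),
      Real.log (coverNum (range φ) ρ).toReal / (-Real.log ρ) ≤ α * V + ε := by
  have q0 := h.q_pos
  have q1 := h.q_lt_one
  have hl2 : 0 < Real.log 2 := Real.log_pos (by norm_num)
  have hlq : Real.log q < 0 := Real.log_neg q0 q1
  obtain ⟨K, T, hK⟩ := h.exists_abs_log_coverNum_sub_le
  have hlim := tendsto_pow_nhdsGT_zero q0 q1
  refine hlim.frequently ((hB.and_eventually ((eventually_ge_atTop (max T 1)).and
    (hlim.eventually (eventually_div_neg_log_le (K + B * Real.log 2) hε)))).mono ?_)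
  rintro t ⟨h3, ht, hC⟩
  have ht0 : (0 : ℝ) < t := Nat.cast_pos.2 ((le_max_right T 1).trans ht)
  have hK' := (abs_le.1 (hK t ((le_max_left T 1).trans ht) (q ^ t)
    (pow_le_pow_of_le_one q0.le q1.le t.le_succ) le_rfl)).2
  have hlog : -Real.log (q ^ t) = t * -Real.log q := by rw [Real.log_pow]; ring
  have hy : 0 < t * -Real.log q := by nlinarith
  rw [hlog] at hC ⊢
  rw [div_le_iff₀ hy] at hC ⊢
  have h4 : (Nat.count p t : ℝ) * Real.log 2 ≤ (V * t + B) * Real.log 2 := by gcongr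
  have h5 : α * V * (t * -Real.log q) = V * t * Real.log 2 := by rw [hα]; ring
  linarith

theorem IsCoding.upperBoxDim_eq (h : IsCoding p φ q A a)
    (hα : Real.log 2 = α * -Real.log q) {U B : ℝ} (hU : 0 ≤ U)
    (hle : ∀ t, (Nat.count p t : ℝ) ≤ U * t + B)
    (hge : ∃ᶠ t : ℕ in atTop, U * t - B ≤ (Nat.count p t : ℝ)) :
    upperBoxDim (range φ) = α * U :=
  limsup_eq_of_forall_pos (fun _ => h.eventually_boxRatio_le hα hU hle)
    fun _ => h.frequently_le_boxRatio hα hge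

theorem IsCoding.lowerBoxDim_eq (h : IsCoding p φ q A a)
    (hα : Real.log 2 = α * -Real.log q) {V B : ℝ} (hV : 0 ≤ V)
    (hge : ∀ t, V * t - B ≤ (Nat.count p t : ℝ))
    (hle : ∃ᶠ t : ℕ in atTop, (Nat.count p t : ℝ) ≤ V * t + B) :
    lowerBoxDim (range φ) = α * V :=
  liminf_eq_of_forall_pos (fun _ => h.eventually_le_boxRatio hα hV hge)
    fun _ => h.frequently_boxRatio_le hα hle

end BoxDim

end Coding

section Cantor

variable {lam : ℕ → ℝ} {q : ℝ}

theorem cantorLen_succ (lam : ℕ → ℝ) (n : ℕ) :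
    cantorLen lam (n + 1) = cantorLen lam n * lam n :=
  Finset.prod_range_succ _ _

theorem cantorLen_pos (hlam : ∀ i, 0 < lam i) (n : ℕ) : 0 < cantorLen lam n :=
  Finset.prod_pos fun i _ => hlam i

/-- The left endpoint of the interval of generation `n` with address `ε`. -/
noncomputable def cantorSum (lam : ℕ → ℝ) (ε : ℕ → Bool) (n : ℕ) : ℝ :=
  ∑ i ∈ Finset.range n, if ε i then cantorLen lam i - cantorLen lam (i + 1) else 0

/-- The point of the Cantor set with address `ε`. -/
noncomputable def cantorPoint (lam : ℕ → ℝ) (ε : ℕ → Bool) : ℝ := ⨆ n, cantorSum lam ε n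

theorem cantorSum_succ (lam : ℕ → ℝ) (ε : ℕ → Bool) (n : ℕ) : cantorSum lam ε (n + 1) =
    cantorSum lam ε n + if ε n then cantorLen lam n - cantorLen lam (n + 1) else 0 :=
  Finset.sum_range_succ _ _

theorem cantorSum_congr {ε ε' : ℕ → Bool} {n : ℕ} (h : ∀ i < n, ε i = ε' i) :
    cantorSum lam ε n = cantorSum lam ε' n :=
  Finset.sum_congr rfl fun i hi => by rw [h i (Finset.mem_range.1 hi)]

theorem mem_cantorPre {n : ℕ} {x : ℝ} : x ∈ cantorPre lam n ↔
    ∃ ε, cantorSum lam ε n ≤ x ∧ x ≤ cantorSum lam ε n + cantorLen lam n := by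
  simp [cantorPre, cantorSum]

theorem cantorLen_antitone (hlam : ∀ i, 0 < lam i) (hlam1 : ∀ i, lam i ≤ 1) :
    Antitone (cantorLen lam) :=
  antitone_nat_of_succ_le fun n => by
    rw [cantorLen_succ]
    exact mul_le_of_le_one_right (cantorLen_pos hlam n).le (hlam1 n)

theorem cantorSum_monotone (hlam : ∀ i, 0 < lam i) (hlam1 : ∀ i, lam i ≤ 1) (ε : ℕ → Bool) :
    Monotone (cantorSum lam ε) :=
  monotone_nat_of_le_succ fun n => by
    have := cantorLen_antitone hlam hlam1 n.le_succ
    rw [cantorSum_succ]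
    split_ifs <;> simp_all

theorem cantorSum_add_cantorLen_antitone (hlam : ∀ i, 0 < lam i) (hlam1 : ∀ i, lam i ≤ 1)
    (ε : ℕ → Bool) : Antitone fun n => cantorSum lam ε n + cantorLen lam n :=
  antitone_nat_of_succ_le fun n => by
    have := cantorLen_antitone hlam hlam1 n.le_succ
    simp only [cantorSum_succ]
    split_ifs <;> linarith

theorem cantorSum_le_add (hlam : ∀ i, 0 < lam i) (hlam1 : ∀ i, lam i ≤ 1)
    (ε : ℕ → Bool) (m n : ℕ) : cantorSum lam ε m ≤ cantorSum lam ε n + cantorLen lam n := by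
  have h1 := cantorSum_monotone hlam hlam1 ε (le_max_left m n)
  have h2 := cantorSum_add_cantorLen_antitone hlam hlam1 ε (le_max_right m n)
  have h3 := cantorLen_pos hlam (max m n)
  simp only at h2
  linarith

theorem cantorPoint_le (hlam : ∀ i, 0 < lam i) (hlam1 : ∀ i, lam i ≤ 1) (ε : ℕ → Bool) (n : ℕ) :
    cantorPoint lam ε ≤ cantorSum lam ε n + cantorLen lam n :=
  ciSup_le fun m => cantorSum_le_add hlam hlam1 ε m n

theorem le_cantorPoint (hlam : ∀ i, 0 < lam i) (hlam1 : ∀ i, lam i ≤ 1) (ε : ℕ → Bool) (n : ℕ) :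
    cantorSum lam ε n ≤ cantorPoint lam ε :=
  le_ciSup (f := cantorSum lam ε)
    ⟨_, by rintro _ ⟨m, rfl⟩; exact cantorSum_le_add hlam hlam1 ε m 0⟩ n

theorem abs_cantorPoint_sub_le (hlam : ∀ i, 0 < lam i) (hlam1 : ∀ i, lam i ≤ 1)
    {ε ε' : ℕ → Bool} {n : ℕ} (h : ∀ i < n, ε i = ε' i) :
    |cantorPoint lam ε - cantorPoint lam ε'| ≤ cantorLen lam n := by
  have h1 := cantorPoint_le hlam hlam1 ε n
  have h2 := le_cantorPoint hlam hlam1 ε n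
  have h3 := cantorPoint_le hlam hlam1 ε' n
  have h4 := le_cantorPoint hlam hlam1 ε' n
  rw [cantorSum_congr h] at h1 h2
  rw [abs_le]
  constructor <;> linarith

/-- Intervals of generation `n` whose addresses first differ at `k < n` are separated by the gap
of generation `k`. -/
theorem cantorSum_gap (hlam : ∀ i, 0 < lam i) (hlam1 : ∀ i, lam i ≤ 1) {ε ε' : ℕ → Bool}
    {k n : ℕ} (hkn : k < n) (h : ∀ i < k, ε i = ε' i) (hk : ε k = true) (hk' : ε' k = false) :
    cantorSum lam ε' n + cantorLen lam n + (cantorLen lam k - 2 * cantorLen lam (k + 1)) ≤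
      cantorSum lam ε n := by
  have h1 := cantorSum_monotone hlam hlam1 ε (Nat.succ_le_of_lt hkn)
  have h2 := cantorSum_add_cantorLen_antitone hlam hlam1 ε' (Nat.succ_le_of_lt hkn)
  simp only [Nat.succ_eq_add_one, cantorSum_succ, hk, hk', if_true, Bool.false_eq_true,
    if_false, cantorSum_congr h] at h1 h2
  linarith

theorem exists_first_ne {ε ε' : ℕ → Bool} {n : ℕ} (hn : ε n ≠ ε' n) :
    ∃ k ≤ n, (∀ i < k, ε i = ε' i) ∧ ε k ≠ ε' k := by
  classical
  have hex : ∃ k, ε k ≠ ε' k := ⟨n, hn⟩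
  exact ⟨Nat.find hex, Nat.find_min' hex hn, fun i hi => not_not.1 (Nat.find_min hex hi),
    Nat.find_spec hex⟩

theorem mul_cantorLen_le_gap (hlam : ∀ i, 0 < lam i) (hq : ∀ i, lam i ≤ q) (k : ℕ) :
    (1 - 2 * q) * cantorLen lam k ≤ cantorLen lam k - 2 * cantorLen lam (k + 1) := by
  rw [cantorLen_succ]
  nlinarith [mul_le_mul_of_nonneg_left (hq k) (cantorLen_pos hlam k).le]

theorem le_abs_cantorPoint_sub (hlam : ∀ i, 0 < lam i) (hq : ∀ i, lam i ≤ q) (hq2 : q < 1 / 2)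
    {ε ε' : ℕ → Bool} {n : ℕ} (hn : ε n ≠ ε' n) :
    (1 - 2 * q) * cantorLen lam n ≤ |cantorPoint lam ε - cantorPoint lam ε'| := by
  have hlam1 : ∀ i, lam i ≤ 1 := fun i => by linarith [hq i]
  obtain ⟨k, hkn, hlt, hk⟩ := exists_first_ne hn
  wlog hε : ε k = true generalizing ε ε'
  · rw [abs_sub_comm]
    exact this hn.symm (fun i hi => (hlt i hi).symm) hk.symm (by
      cases h1 : ε k <;> cases h2 : ε' k <;> simp_all)
  have hε' : ε' k = false := by cases h2 : ε' k <;> simp_all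
  have h1 := cantorSum_gap hlam hlam1 (Nat.lt_succ_of_le hkn) hlt hε hε'
  have h2 := le_cantorPoint hlam hlam1 ε (n + 1)
  have h3 := cantorPoint_le hlam hlam1 ε' (n + 1)
  have h4 := mul_cantorLen_le_gap hlam hq k
  have h5 := cantorLen_antitone hlam hlam1 hkn
  have h6 : (1 - 2 * q) * cantorLen lam n ≤ (1 - 2 * q) * cantorLen lam k := by
    apply mul_le_mul_of_nonneg_left h5; linarith
  refine le_trans ?_ (le_abs_self _)
  simp only [Nat.succ_eq_add_one] at h1
  linarith

theorem cantorLen_le_pow (hlam : ∀ i, 0 < lam i) (hq : ∀ i, lam i ≤ q) (n : ℕ) :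
    cantorLen lam n ≤ q ^ n := by
  simpa [cantorLen] using
    Finset.prod_le_prod (s := Finset.range n) (fun i _ => (hlam i).le) fun i _ => hq i

theorem cantorSet_eq_range (hlam : ∀ i, 0 < lam i) (hq : ∀ i, lam i ≤ q) (hq2 : q < 1 / 2) :
    cantorSet lam = range (cantorPoint lam) := by
  have hlam1 : ∀ i, lam i ≤ 1 := fun i => by linarith [hq i]
  have hq0 : 0 < q := (hlam 0).trans_le (hq 0)
  ext x
  simp only [cantorSet, mem_iInter, mem_cantorPre, mem_range]
  constructor
  · intro hx
    choose e he he' using hx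
    have hcoh : ∀ m n, ∀ i < m, i < n → e m i = e n i := by
      intro m n i him hin
      by_contra hne
      obtain ⟨k, hki, hlt, hk⟩ := exists_first_ne hne
      have hkm := hki.trans_lt him
      have hkn := hki.trans_lt hin
      wlog hε : e m k = true generalizing m n
      · exact this n m hin him (Ne.symm hne) (fun j hj => (hlt j hj).symm) hk.symm hkn hkm (by
          cases h1 : e m k <;> cases h2 : e n k <;> simp_all)
      have hε' : e n k = false := by cases h2 : e n k <;> simp_all
      have hgap : 0 < cantorLen lam k - 2 * cantorLen lam (k + 1) :=
        lt_of_lt_of_le (mul_pos (by linarith) (cantorLen_pos hlam k))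
          (mul_cantorLen_le_gap hlam hq k)
      have h1 := cantorSum_gap hlam hlam1 k.lt_succ_self hlt hε hε'
      have h2 := cantorSum_monotone hlam hlam1 (e m) (Nat.succ_le_of_lt hkm)
      have h3 := cantorSum_add_cantorLen_antitone hlam hlam1 (e n) (Nat.succ_le_of_lt hkn)
      simp only [Nat.succ_eq_add_one] at h1 h2 h3
      linarith [he m, he' n]
    refine ⟨fun i => e (i + 1) i, eq_of_abs_sub_nonpos (ge_of_tendsto'
      (tendsto_pow_atTop_nhds_zero_of_lt_one hq0.le (by linarith : q < 1)) fun n => ?_)⟩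
    refine le_trans ?_ (cantorLen_le_pow hlam hq n)
    have h1 := cantorPoint_le hlam hlam1 (fun i => e (i + 1) i) n
    have h2 := le_cantorPoint hlam hlam1 (fun i => e (i + 1) i) n
    rw [cantorSum_congr fun i hi => hcoh (i + 1) n i i.lt_succ_self hi] at h1 h2
    rw [abs_le]
    constructor <;> linarith [he n, he' n]
  · rintro ⟨ε, rfl⟩ n
    exact ⟨ε, le_cantorPoint hlam hlam1 ε n, cantorPoint_le hlam hlam1 ε n⟩

theorem cantorSet_subset_Icc (lam : ℕ → ℝ) : cantorSet lam ⊆ Icc 0 1 := by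
  intro x hx
  obtain ⟨ε, h1, h2⟩ := mem_cantorPre.1 (mem_iInter.1 hx 0)
  simp only [cantorSum, cantorLen, Finset.range_zero, Finset.sum_empty, Finset.prod_empty,
    zero_add] at h1 h2
  exact ⟨h1, h2⟩

/-- Ratios for which the `n`-th generation is of length comparable to `q ^ T`, `T` being the
`n`-th time satisfying `p`. -/
noncomputable def scheduleRatio (q : ℝ) (p : ℕ → Prop) (i : ℕ) : ℝ :=
  q ^ (Nat.nth p (i + 1) - Nat.nth p i)

variable {p : ℕ → Prop}

theorem scheduleRatio_pos (hq : 0 < q) (i : ℕ) : 0 < scheduleRatio q p i := pow_pos hq _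

theorem scheduleRatio_le (hq : 0 < q) (hq1 : q ≤ 1) (hp : {n | p n}.Infinite) (i : ℕ) :
    scheduleRatio q p i ≤ q := by
  have := Nat.nth_strictMono hp i.lt_succ_self
  exact pow_le_of_le_one hq.le hq1 (Nat.sub_pos_of_lt this).ne'

theorem cantorLen_scheduleRatio (hp : {n | p n}.Infinite) (n : ℕ) :
    cantorLen (scheduleRatio q p) n * q ^ Nat.nth p 0 = q ^ Nat.nth p n := by
  induction n with
  | zero => simp [cantorLen]
  | succ n ih =>
    rw [cantorLen_succ, mul_right_comm, ih, scheduleRatio, ← pow_add,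
      Nat.add_sub_cancel' (Nat.nth_strictMono hp n.lt_succ_self).le]

theorem isCoding_cantor [DecidablePred p] (hq : 0 < q) (hq2 : q < 1 / 2)
    (hp : {n | p n}.Infinite) :
    IsCoding p (fun x : ℕ → Bool => cantorPoint (scheduleRatio q p) (x ∘ Nat.nth p)) q
      (q ^ Nat.nth p 0)⁻¹ (1 - 2 * q) := by
  have hq1 : q < 1 := by linarith
  have hpos := scheduleRatio_pos (p := p) hq
  have hle := scheduleRatio_le hq hq1.le hp
  have hone : 1 ≤ (q ^ Nat.nth p 0)⁻¹ :=
    (one_le_inv₀ (by positivity)).2 (pow_le_one₀ hq.le hq1.le)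
  have hlen : ∀ n, cantorLen (scheduleRatio q p) n = (q ^ Nat.nth p 0)⁻¹ * q ^ Nat.nth p n :=
    fun n => by rw [← cantorLen_scheduleRatio hp n]; field_simp
  refine ⟨hq, hq1, by linarith, by linarith, fun t x y h => ?_, fun t x y s hs hps h => ?_⟩
  · refine (abs_cantorPoint_sub_le hpos (fun i => (hle i).trans hq1.le)
      (n := Nat.count p t) fun i hi =>
        h _ (Nat.nth_lt_of_lt_count hi) (Nat.nth_mem_of_infinite hp i)).trans ?_
    rw [hlen]
    exact mul_le_mul_of_nonneg_left
      (pow_le_pow_of_le_one hq.le hq1.le (Nat.le_nth_count hp t)) (by positivity)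
  · have h' : (x ∘ Nat.nth p) (Nat.count p s) ≠ (y ∘ Nat.nth p) (Nat.count p s) := by
      simpa [Nat.nth_count hps] using h
    refine le_trans (mul_le_mul_of_nonneg_left ?_ (by linarith))
      (le_abs_cantorPoint_sub hpos hle hq2 h')
    rw [hlen, Nat.nth_count hps]
    calc q ^ t ≤ q ^ s := pow_le_pow_of_le_one hq.le hq1.le hs.le
      _ ≤ _ := le_mul_of_one_le_left (by positivity) hone

theorem range_cantorPoint_comp_nth (hp : {n | p n}.Infinite) (lam : ℕ → ℝ) :
    range (fun x : ℕ → Bool => cantorPoint lam (x ∘ Nat.nth p)) = range (cantorPoint lam) :=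
  ((Nat.nth_injective hp).surjective_comp_right (γ := Bool)).range_comp (cantorPoint lam)

end Cantor

section Product

variable {p : ℕ → Prop} {q A a A' a' : ℝ} {φ ψ : (ℕ → Bool) → ℝ}

theorem IsCoding.congr {X : Type*} [MetricSpace X] {φ : (ℕ → Bool) → X} (h : IsCoding p φ q A a)
    {x y : ℕ → Bool} (hxy : ∀ s, p s → x s = y s) : φ x = φ y := by
  refine dist_le_zero.1 (ge_of_tendsto' (x := atTop) ?_ fun t => h.dist_le t x y fun s _ => hxy s)
  simpa using (tendsto_pow_atTop_nhds_zero_of_lt_one h.q_pos.le h.q_lt_one).const_mul A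

theorem IsCoding.prod (h : IsCoding p φ q A a) (h' : IsCoding (fun s => ¬ p s) ψ q A' a') :
    IsCoding (fun _ => True) (fun x => WithLp.toLp 2 (φ x, ψ x)) q (A + A') (min a a') := by
  have hmin : 0 < min a a' := lt_min h.a_pos h'.a_pos
  have hA' : 0 < A' := h'.a_pos.trans_le h'.a_le
  refine ⟨h.q_pos, h.q_lt_one, hmin, (min_le_left _ _).trans (by linarith [h.a_le]),
    fun t x y hxy => ?_, fun t x y s hs _ hne => ?_⟩
  · rw [WithLp.prod_dist_eq_of_L2]
    have h1 := h.dist_le t x y fun s hs _ => hxy s hs trivial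
    have h2 := h'.dist_le t x y fun s hs _ => hxy s hs trivial
    have h3 := dist_nonneg (x := φ x) (y := φ y)
    have h4 := dist_nonneg (x := ψ x) (y := ψ y)
    refine Real.sqrt_le_iff.2 ⟨by nlinarith, ?_⟩
    calc dist (φ x) (φ y) ^ 2 + dist (ψ x) (ψ y) ^ 2
        ≤ (dist (φ x) (φ y) + dist (ψ x) (ψ y)) ^ 2 := by nlinarith
      _ ≤ _ := by
        rw [add_mul]
        gcongr
  · rw [WithLp.prod_dist_eq_of_L2]
    have hqt := pow_pos h.q_pos t
    by_cases hps : p s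
    · refine le_trans ((mul_le_mul_of_nonneg_right (min_le_left _ _) hqt.le).trans
        (h.le_dist t x y s hs hps hne)) (Real.le_sqrt_of_sq_le ?_)
      exact le_add_of_nonneg_right (sq_nonneg _)
    · refine le_trans ((mul_le_mul_of_nonneg_right (min_le_right _ _) hqt.le).trans
        (h'.le_dist t x y s hs hps hne)) (Real.le_sqrt_of_sq_le ?_)
      exact le_add_of_nonneg_left (sq_nonneg _)

theorem IsCoding.range_prod (h : IsCoding p φ q A a)
    (h' : IsCoding (fun s => ¬ p s) ψ q A' a') :
    range (fun x => WithLp.toLp 2 (φ x, ψ x)) = prodSetL2 (range φ) (range ψ) := by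
  classical
  ext z
  constructor
  · rintro ⟨x, rfl⟩
    exact ⟨(φ x, ψ x), ⟨⟨x, rfl⟩, ⟨x, rfl⟩⟩, rfl⟩
  · rintro ⟨⟨_, _⟩, ⟨⟨x, rfl⟩, ⟨y, rfl⟩⟩, rfl⟩
    refine ⟨fun s => if p s then x s else y s, ?_⟩
    have h1 : φ (fun s => if p s then x s else y s) = φ x := h.congr fun s hs => if_pos hs
    have h2 : ψ (fun s => if p s then x s else y s) = ψ y := h'.congr fun s hs => if_neg hs
    simp only [h1, h2]
    rfl

end Product

section Schedule

/-- A nondecreasing `1`-Lipschitz function oscillating between the lines of slopes `g` and `b`. -/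
theorem exists_profile {g b M K : ℝ} (hg : 0 < g) (hgb : g < b) (hb : b < 1)
    (hM : (1 - b) * M = 1 - g) (hK : g * K = b * M) :
    ∃ F : ℝ → ℝ, Monotone F ∧ (∀ t, 0 ≤ F t) ∧ (∀ t, F (t + 1) ≤ F t + 1) ∧
      (∀ t, 0 ≤ t → F t ≤ b * t) ∧ (∀ t, 1 ≤ t → g * t ≤ F t) ∧
      ∀ j : ℕ, b * (M * K ^ j) ≤ F (M * K ^ j) ∧ F (K ^ j) ≤ g * K ^ j := by
  have hM1 : 1 < M := by nlinarith
  have hMK : M < K := by nlinarith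
  have hK1 : 1 < K := hM1.trans hMK
  let f : ℕ → ℝ → ℝ := fun j t => min (t - (1 - g) * K ^ j) (g * K ^ (j + 1))
  have e1 : ∀ j : ℕ, g * K ^ (j + 1) = b * (M * K ^ j) := fun j => by
    rw [pow_succ]; linear_combination K ^ j * hK
  have e2 : ∀ j : ℕ, (1 - g) * K ^ j = (1 - b) * (M * K ^ j) := fun j => by
    linear_combination -K ^ j * hM
  have hfle : ∀ j t, f j t ≤ b * t := by
    intro j t
    have h1 : f j t ≤ t - (1 - b) * (M * K ^ j) := by rw [← e2]; exact min_le_left _ _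
    have h2 : f j t ≤ b * (M * K ^ j) := by rw [← e1]; exact min_le_right _ _
    nlinarith
  have hbdd : ∀ t, BddAbove (range fun j => f j t) := fun t =>
    ⟨b * t, by rintro _ ⟨j, rfl⟩; exact hfle j t⟩
  refine ⟨fun t => max 0 (⨆ j, f j t), fun s t hst => ?_, fun t => le_max_left _ _, fun t => ?_,
    fun t ht => ?_, fun t ht => ?_, fun j => ⟨?_, ?_⟩⟩
  · refine max_le_max le_rfl (ciSup_mono (hbdd t) fun j => ?_)
    exact min_le_min (by linarith) le_rfl
  · refine max_le (by linarith [le_max_left 0 (⨆ j, f j t)]) (ciSup_le fun j => ?_)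
    have h1 : f j t ≤ max 0 (⨆ j, f j t) := (le_ciSup (hbdd t) j).trans (le_max_right _ _)
    have h2 : f j (t + 1) ≤ f j t + 1 := by
      simp only [f]
      rw [← min_add_add_right]
      exact min_le_min (by linarith) (by linarith)
    linarith
  · exact max_le (by nlinarith) (ciSup_le fun j => hfle j t)
  · obtain ⟨j, hj, hj'⟩ := exists_nat_pow_near ht hK1
    refine le_trans (le_min ?_ ?_) ((le_ciSup (hbdd t) j).trans (le_max_right _ _))
    · nlinarith
    · gcongr
  · refine le_trans (le_min ?_ ?_) ((le_ciSup (hbdd (M * K ^ j)) j).trans (le_max_right _ _))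
    · rw [e2]; linarith
    · rw [e1]
  · have hKj : 0 < K ^ j := by positivity
    refine max_le (by positivity) (ciSup_le fun i => ?_)
    rcases lt_or_ge i j with hij | hij
    · refine (min_le_right _ _).trans ?_
      exact mul_le_mul_of_nonneg_left (pow_le_pow_right₀ hK1.le hij) hg.le
    · refine (min_le_left _ _).trans ?_
      have := pow_le_pow_right₀ hK1.le hij
      nlinarith

theorem count_add_count_not (p : ℕ → Prop) [DecidablePred p] (n : ℕ) :
    Nat.count p n + Nat.count (fun k => ¬ p k) n = n := by
  induction n with
  | zero => simp
  | succ n ih =>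
    rw [Nat.count_succ, Nat.count_succ]
    split_ifs <;> omega

theorem count_jump {c : ℕ → ℕ} (h0 : c 0 = 0) (hmono : Monotone c)
    (hstep : ∀ t, c (t + 1) ≤ c t + 1) (t : ℕ) :
    Nat.count (fun s => c (s + 1) = c s + 1) t = c t := by
  induction t with
  | zero => simp [h0]
  | succ t ih =>
    rw [Nat.count_succ, ih]
    have h1 := hmono (Nat.le_add_right t 1)
    have h2 := hstep t
    split_ifs <;> omega

theorem exists_schedule {g b : ℝ} (hg : 0 < g) (hgb : g < b) (hb : b < 1) :
    ∃ (p : ℕ → Prop) (_ : DecidablePred p),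
      (∀ t, g * t - 2 ≤ (Nat.count p t : ℝ)) ∧ (∀ t, (Nat.count p t : ℝ) ≤ b * t) ∧
      (∃ᶠ t : ℕ in atTop, b * t - 2 ≤ (Nat.count p t : ℝ)) ∧
      (∃ᶠ t : ℕ in atTop, (Nat.count p t : ℝ) ≤ g * t + 2) ∧
      HasDenseBlocks p ∧ HasDenseBlocks fun s => ¬ p s := by
  obtain ⟨M, hM⟩ : ∃ M, (1 - b) * M = 1 - g := ⟨(1 - g) / (1 - b), mul_div_cancel₀ _ (by linarith)⟩
  obtain ⟨K, hK⟩ : ∃ K, g * K = b * M := ⟨b * M / g, mul_div_cancel₀ _ hg.ne'⟩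
  have hM1 : 1 < M := by nlinarith
  have hMK : M < K := by nlinarith
  have hK1 : 1 < K := hM1.trans hMK
  obtain ⟨F, hmono, h0, hstep, hFb, hFg, hF⟩ := exists_profile hg hgb hb hM hK
  have hcount : ∀ t : ℕ,
      Nat.count (fun s : ℕ => ⌊F ((s + 1 : ℕ) : ℝ)⌋₊ = ⌊F (s : ℝ)⌋₊ + 1) t = ⌊F t⌋₊ := by
    refine count_jump (c := fun t : ℕ => ⌊F t⌋₊) ?_ ?_ ?_
    · rw [Nat.floor_eq_zero]
      exact (hFb _ (Nat.cast_nonneg _)).trans_lt (by simp)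
    · exact fun s t hst => Nat.floor_mono (hmono (Nat.cast_le.2 hst))
    · intro t
      rw [← Nat.floor_add_one (h0 _)]
      exact Nat.floor_mono (by push_cast; exact hstep _)
  have hlow : ∀ t : ℕ, F t - 1 ≤ (⌊F t⌋₊ : ℝ) := fun t => (Nat.sub_one_lt_floor _).le
  have hup : ∀ t : ℕ, (⌊F t⌋₊ : ℝ) ≤ F t := fun t => Nat.floor_le (h0 _)
  have hKpos : ∀ j : ℕ, 0 < K ^ j := fun j => by positivity
  have htop : ∀ C : ℝ, ∃ j : ℕ, C < K ^ j := fun C => pow_unbounded_of_one_lt C hK1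
  have hpeak : ∀ j : ℕ, b * (M * K ^ j) - 1 ≤ (⌊F (⌈M * K ^ j⌉₊ : ℕ)⌋₊ : ℝ) := fun j => by
    linarith [hlow ⌈M * K ^ j⌉₊, (hF j).1, hmono (Nat.le_ceil (M * K ^ j))]
  have hvalley : ∀ j : ℕ, (⌊F (⌊K ^ j⌋₊ : ℕ)⌋₊ : ℝ) ≤ g * K ^ j := fun j => by
    linarith [hup ⌊K ^ j⌋₊, (hF j).2, hmono (Nat.floor_le (hKpos j).le)]
  have hceil : ∀ j : ℕ, (⌈M * K ^ j⌉₊ : ℝ) < M * K ^ j + 1 := fun j =>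
    Nat.ceil_lt_add_one (by positivity)
  refine ⟨fun s : ℕ => ⌊F ((s + 1 : ℕ) : ℝ)⌋₊ = ⌊F (s : ℝ)⌋₊ + 1, fun _ => inferInstance,
    fun t => ?_, fun t => ?_, ?_, ?_, ⟨3, fun k => ?_⟩,
    ⟨3, fun k => ?_⟩⟩
  · rw [hcount]
    rcases Nat.eq_zero_or_pos t with rfl | ht
    · have : (0 : ℝ) ≤ (⌊F ((0 : ℕ) : ℝ)⌋₊ : ℝ) := Nat.cast_nonneg _
      simp only [Nat.cast_zero, mul_zero] at this ⊢
      linarith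
    · linarith [hlow t, hFg t (by exact_mod_cast ht)]
  · rw [hcount]
    exact (hup t).trans (hFb t (Nat.cast_nonneg _))
  · refine frequently_atTop.2 fun N => ?_
    obtain ⟨j, hj⟩ := htop N
    refine ⟨⌈M * K ^ j⌉₊, ?_, ?_⟩
    · have : (N : ℝ) ≤ ⌈M * K ^ j⌉₊ := by nlinarith [Nat.le_ceil (M * K ^ j), hKpos j]
      exact_mod_cast this
    · rw [hcount]
      nlinarith [hpeak j, hceil j]
  · refine frequently_atTop.2 fun N => ?_
    obtain ⟨j, hj⟩ := htop N
    refine ⟨⌊K ^ j⌋₊, Nat.le_floor hj.le, ?_⟩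
    rw [hcount]
    nlinarith [hvalley j, Nat.lt_floor_add_one (K ^ j)]
  · obtain ⟨j, hj⟩ := htop (k / (M - 1))
    rw [div_lt_iff₀ (by linarith)] at hj
    refine ⟨⌊K ^ j⌋₊, ⌈M * K ^ j⌉₊, ?_, ?_⟩
    · have : (⌊K ^ j⌋₊ + k : ℝ) ≤ ⌈M * K ^ j⌉₊ := by
        nlinarith [Nat.floor_le (hKpos j).le, Nat.le_ceil (M * K ^ j)]
      exact_mod_cast this
    · rw [hcount, hcount]
      have h1 : b * (M * K ^ j) - g * K ^ j = (M - 1) * K ^ j := by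
        linear_combination -K ^ j * hM
      have : (⌈M * K ^ j⌉₊ + ⌊F (⌊K ^ j⌋₊ : ℕ)⌋₊ : ℝ) ≤
          ⌊K ^ j⌋₊ + ⌊F (⌈M * K ^ j⌉₊ : ℕ)⌋₊ + 3 := by
        linarith [hpeak j, hvalley j, hceil j, Nat.lt_floor_add_one (K ^ j)]
      exact_mod_cast this
  · obtain ⟨j, hj⟩ := htop ((k + 2) / (K - M))
    rw [div_lt_iff₀ (by linarith)] at hj
    have htt : ⌈M * K ^ j⌉₊ + k ≤ ⌊K ^ (j + 1)⌋₊ := by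
      have : (⌈M * K ^ j⌉₊ + k : ℝ) ≤ ⌊K ^ (j + 1)⌋₊ := by
        have := Nat.lt_floor_add_one (K ^ (j + 1))
        rw [pow_succ] at this ⊢
        linarith [hceil j]
      exact_mod_cast this
    refine ⟨⌈M * K ^ j⌉₊, ⌊K ^ (j + 1)⌋₊, htt, ?_⟩
    have h1 := count_add_count_not
      (fun s : ℕ => ⌊F ((s + 1 : ℕ) : ℝ)⌋₊ = ⌊F (s : ℝ)⌋₊ + 1) ⌈M * K ^ j⌉₊
    have h2 := count_add_count_not
      (fun s : ℕ => ⌊F ((s + 1 : ℕ) : ℝ)⌋₊ = ⌊F (s : ℝ)⌋₊ + 1) ⌊K ^ (j + 1)⌋₊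
    have h3 : ⌊F (⌊K ^ (j + 1)⌋₊ : ℕ)⌋₊ ≤ ⌊F (⌈M * K ^ j⌉₊ : ℕ)⌋₊ + 1 := by
      have h4 : g * K ^ (j + 1) = b * (M * K ^ j) := by
        rw [pow_succ]; linear_combination K ^ j * hK
      have : (⌊F (⌊K ^ (j + 1)⌋₊ : ℕ)⌋₊ : ℝ) ≤ ⌊F (⌈M * K ^ j⌉₊ : ℕ)⌋₊ + 1 := by
        linarith [hpeak j, hvalley (j + 1)]
      exact_mod_cast this
    rw [hcount] at h1 h2
    beta_reduce at h1 h2 ⊢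
    omega

theorem infinite_of_le_count {p : ℕ → Prop} [DecidablePred p] {g B : ℝ} (hg : 0 < g)
    (h : ∀ t, g * t - B ≤ (Nat.count p t : ℝ)) : {n | p n}.Infinite := by
  intro hfin
  obtain ⟨t, ht⟩ := exists_nat_gt ((hfin.toFinset.card + B) / g)
  rw [div_lt_iff₀ hg] at ht
  have hcard : Nat.count p t ≤ hfin.toFinset.card := by
    rw [Nat.count_eq_card_filter_range]
    exact Finset.card_le_card fun n hn => by simpa using (Finset.mem_filter.1 hn).2
  have : (Nat.count p t : ℝ) ≤ hfin.toFinset.card := by exact_mod_cast hcard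
  linarith [h t]

end Schedule

theorem statement18 (α β γ : ℝ) (hα : α ∈ Set.Ioo (0 : ℝ) 1) (hβ : β ∈ Set.Ioo (0 : ℝ) 1)
    (hγ : γ ∈ Set.Ioo (0 : ℝ) 1) (hβγ : 1 < β + γ) :
    ∃ lam mu : ℕ → ℝ,
      (∀ i, lam i ∈ Set.Ioo (0 : ℝ) (1 / 2)) ∧ (∀ i, mu i ∈ Set.Ioo (0 : ℝ) (1 / 2)) ∧
      cantorSet lam ⊆ Set.Icc 0 1 ∧ cantorSet mu ⊆ Set.Icc 0 1 ∧
      lowerBoxDim (cantorSet lam) = α * (1 - γ) ∧ upperBoxDim (cantorSet lam) = α * β ∧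
      lowerBoxDim (cantorSet mu) = α * (1 - β) ∧ upperBoxDim (cantorSet mu) = α * γ ∧
      lowerBoxDim (prodSetL2 (cantorSet lam) (cantorSet mu)) = α ∧
      upperBoxDim (prodSetL2 (cantorSet lam) (cantorSet mu)) = α ∧
      assouadDim (prodSetL2 (cantorSet lam) (cantorSet mu)) = (α : EReal) ∧
      assouadDim (cantorSet lam) = (α : EReal) ∧
      assouadDim (cantorSet mu) = (α : EReal) := by
  obtain ⟨hα0, hα1⟩ := hα
  obtain ⟨hβ0, hβ1⟩ := hβ
  obtain ⟨hγ0, hγ1⟩ := hγ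
  obtain ⟨p, _, hlow, hup, hpeak, hvalley, hdense, hdense'⟩ :=
    exists_schedule (g := 1 - γ) (b := β) (by linarith) (by linarith) hβ1
  have hnot : ∀ t, (Nat.count (fun s => ¬ p s) t : ℝ) = t - Nat.count p t := fun t => by
    rw [eq_sub_iff_add_eq']
    exact_mod_cast count_add_count_not p t
  have hlow' : ∀ t, (1 - β) * t - 2 ≤ (Nat.count (fun s => ¬ p s) t : ℝ) := fun t => by
    linarith [hnot t, hup t]
  have hp := infinite_of_le_count (by linarith) hlow
  have hp' := infinite_of_le_count (by linarith) hlow'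
  obtain ⟨q, hq⟩ : ∃ q : ℝ, q = 2⁻¹ ^ α⁻¹ := ⟨_, rfl⟩
  have hq0 : 0 < q := hq ▸ by positivity
  have hqα : q ^ α = 2⁻¹ := by
    rw [hq, ← Real.rpow_mul (by norm_num), inv_mul_cancel₀ hα0.ne', Real.rpow_one]
  have hq2 : q < 1 / 2 := by
    have := Real.rpow_lt_rpow_of_exponent_gt (x := 2⁻¹) (by norm_num) (by norm_num)
      ((one_lt_inv₀ hα0).2 hα1)
    rw [Real.rpow_one, ← hq] at this
    linarith
  have hlog : Real.log 2 = α * -Real.log q := by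
    have := congrArg Real.log hqα
    rw [Real.log_rpow hq0, Real.log_inv] at this
    linarith
  have hC := isCoding_cantor hq0 hq2 hp
  have hD := isCoding_cantor hq0 hq2 hp'
  have hCD := hC.prod hD
  have hrCD := hC.range_prod hD
  have hrC : cantorSet (scheduleRatio q p) = _ :=
    (cantorSet_eq_range (scheduleRatio_pos hq0)
      (scheduleRatio_le hq0 (by linarith) hp) hq2).trans (range_cantorPoint_comp_nth hp _).symm
  have hrD : cantorSet (scheduleRatio q fun s => ¬ p s) = _ :=
    (cantorSet_eq_range (scheduleRatio_pos hq0)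
      (scheduleRatio_le hq0 (by linarith) hp') hq2).trans (range_cantorPoint_comp_nth hp' _).symm
  refine ⟨scheduleRatio q p, scheduleRatio q fun s => ¬ p s,
    fun i => ⟨scheduleRatio_pos hq0 i, (scheduleRatio_le hq0 (by linarith) hp i).trans_lt hq2⟩,
    fun i => ⟨scheduleRatio_pos hq0 i, (scheduleRatio_le hq0 (by linarith) hp' i).trans_lt hq2⟩,
    cantorSet_subset_Icc _, cantorSet_subset_Icc _, ?_⟩
  rw [hrC, hrD, ← hrCD]
  refine ⟨hC.lowerBoxDim_eq hlog (by linarith) hlow hvalley,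
    hC.upperBoxDim_eq hlog (B := 2) hβ0.le (fun t => by linarith [hup t]) hpeak,
    hD.lowerBoxDim_eq hlog (by linarith) hlow' (hpeak.mono fun t ht => ?_),
    hD.upperBoxDim_eq hlog (B := 2) hγ0.le (fun t => ?_) (hvalley.mono fun t ht => ?_),
    ?_, ?_, ?_, hC.assouadDim_eq hα0 hqα hdense, hD.assouadDim_eq hα0 hqα hdense'⟩
  · linarith [hnot t]
  · linarith [hnot t, hlow t]
  · linarith [hnot t]
  · simpa using hCD.lowerBoxDim_eq hlog (V := 1) (B := 0) zero_le_one (fun t => by simp)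
      (Frequently.of_forall fun t => by simp)
  · simpa using hCD.upperBoxDim_eq hlog (U := 1) (B := 0) zero_le_one (fun t => by simp)
      (Frequently.of_forall fun t => by simp)
  · exact hCD.assouadDim_eq hα0 hqα ⟨0, fun k => ⟨0, k, by simp, by simp⟩⟩

end Paper
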